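/- Let G be the graph obtained from the complete bipartite graph K_{4,4}, with parts {a1,a2,a3,a4} and {b1,b2,b3,b4}, by deleting the edge (a1,b1), and let w be a ℤ/2-edge-weighting of G. It is impossible that simultaneously: (i) the induced complete bipartite subgraph A on {a2,a3,a4} ∪ {b2,b3,b4} has a 4-pattern with including edge (a4,b4), i.e., a 4-cycle of A is odd if and only if it contains the edge (a4,b4); and (ii) the induced complete bipartite subgraph B on {a1,a2,a3} ∪ {b2,b3,b4} has a 6-pattern, i.e., there is a set F of three pairwise vertex-disjoint edges of B such that a 4-cycle of B is odd if and only if it contains at most one edge of F. -/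

import Mathlib

open SimpleGraph

/-- The graph `K_{4,4}` minus the edge `(a1, b1)`, where `aᵢ = Sum.inl (i-1)` and
`bⱼ = Sum.inr (j-1)`. -/
def K44me : SimpleGraph (Fin 4 ⊕ Fin 4) :=
  (completeBipartiteGraph (Fin 4) (Fin 4)).deleteEdges {s(Sum.inl 0, Sum.inr 0)}

/-- The ℤ/2-weight of a closed walk: the sum of the weights of its edges. -/
def cycWeight (w : Sym2 (Fin 4 ⊕ Fin 4) → ZMod 2) {v : Fin 4 ⊕ Fin 4}
    (c : K44me.Walk v v) : ZMod 2 :=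
  (c.edges.map w).sum

theorem K44me_adj_inl_inr {i j : Fin 4} (hj : j ≠ 0) :
    K44me.Adj (Sum.inl i) (Sum.inr j) := by
  simp [K44me, hj]

/-- The closed walk `aᵢ bⱼ aₖ bₗ aᵢ`. -/
def quadWalk (i k : Fin 4) {j l : Fin 4} (hj : j ≠ 0) (hl : l ≠ 0) :
    K44me.Walk (Sum.inl i) (Sum.inl i) :=
  .cons (K44me_adj_inl_inr hj) <| .cons (K44me_adj_inl_inr (i := k) hj).symm <|
    .cons (K44me_adj_inl_inr hl) <| .cons (K44me_adj_inl_inr hl).symm .nil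

theorem quadWalk_isCycle {i k j l : Fin 4} (hj : j ≠ 0) (hl : l ≠ 0) (hik : i ≠ k)
    (hjl : j ≠ l) : (quadWalk i k hj hl).IsCycle := by
  simp [quadWalk, Walk.cons_isCycle_iff, hik, hik.symm, hjl]

theorem edges_quadWalk {i k j l : Fin 4} (hj : j ≠ 0) (hl : l ≠ 0) :
    (quadWalk i k hj hl).edges =
      [s(Sum.inl i, Sum.inr j), s(Sum.inr j, Sum.inl k),
        s(Sum.inl k, Sum.inr l), s(Sum.inr l, Sum.inl i)] := rfl

theorem support_quadWalk {i k j l : Fin 4} (hj : j ≠ 0) (hl : l ≠ 0) :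
    (quadWalk i k hj hl).support =
      [Sum.inl i, Sum.inr j, Sum.inl k, Sum.inr l, Sum.inl i] := rfl

/-- A set of pairwise disjoint edges that meets a 4-cycle in at least two edges contains an edge
of that cycle at its first vertex. -/
theorem mem_or_mem_of_two_le_card {F : Finset (Sym2 (Fin 4 ⊕ Fin 4))}
    (hF : ∀ e ∈ F, ∀ f ∈ F, e ≠ f → ∀ x, ¬(x ∈ e ∧ x ∈ f)) {i k j l : Fin 4}
    (hj : j ≠ 0) (hl : l ≠ 0)
    (hcard : 1 < (F.filter (· ∈ (quadWalk i k hj hl).edges)).card) :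
    s(Sum.inl i, Sum.inr j) ∈ F ∨ s(Sum.inl i, Sum.inr l) ∈ F := by
  obtain ⟨e, he, f, hf, hef⟩ := Finset.one_lt_card.mp hcard
  simp only [Finset.mem_filter, edges_quadWalk, List.mem_cons, List.not_mem_nil, or_false,
    Sym2.eq_swap (a := Sum.inr l)] at he hf
  obtain ⟨he, he'⟩ := he
  obtain ⟨hf, hf'⟩ := hf
  have hk := hF e he f hf hef (Sum.inl k)
  rcases he' with rfl | rfl | rfl | rfl
  · exact .inl he
  all_goals first
    | exact .inr he
    | rcases hf' with rfl | rfl | rfl | rfl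
      · exact .inl hf
      · simp at hk
      · simp at hk
      · exact .inr hf

/-- let `G = K_{4,4} - (a1,b1)` with a ℤ/2-edge-weighting `w`.  It is
impossible that simultaneously:
(i) the induced subgraph `A` on `{a2,a3,a4} ∪ {b2,b3,b4}` has a 4-pattern with including
edge `(a4,b4)`: a 4-cycle of `G` avoiding `a1` and `b1` is odd iff it contains `(a4,b4)`;
and (ii) the induced subgraph `B` on `{a1,a2,a3} ∪ {b2,b3,b4}` has a 6-pattern: there is a
set `F` of three pairwise vertex-disjoint edges of `B` such that a 4-cycle of `G` avoiding
`a4` and `b1` is odd iff it contains at most one edge of `F`. -/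
theorem stmt6 (w : Sym2 (Fin 4 ⊕ Fin 4) → ZMod 2)
    (hA : ∀ (v : Fin 4 ⊕ Fin 4) (c : K44me.Walk v v), c.IsCycle → c.length = 4 →
      Sum.inl 0 ∉ c.support → Sum.inr 0 ∉ c.support →
      (cycWeight w c = 1 ↔ s(Sum.inl 3, Sum.inr 3) ∈ c.edges))
    (hB : ∃ F : Finset (Sym2 (Fin 4 ⊕ Fin 4)), F.card = 3 ∧
      (∀ e ∈ F, e ∈ K44me.edgeSet ∧ ∀ x ∈ e, x ≠ Sum.inl 3 ∧ x ≠ Sum.inr 0) ∧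
      (∀ e ∈ F, ∀ f ∈ F, e ≠ f → ∀ x, ¬(x ∈ e ∧ x ∈ f)) ∧
      ∀ (v : Fin 4 ⊕ Fin 4) (c : K44me.Walk v v), c.IsCycle → c.length = 4 →
        Sum.inl 3 ∉ c.support → Sum.inr 0 ∉ c.support →
        (cycWeight w c = 1 ↔ (F.filter (· ∈ c.edges)).card ≤ 1)) :
    False := by
  obtain ⟨F, -, -, hF, hB⟩ := hB
  have key {j l : Fin 4} (hj : j ≠ 0) (hl : l ≠ 0) (hjl : j ≠ l) :
      s(Sum.inl 1, Sum.inr j) ∈ F ∨ s(Sum.inl 1, Sum.inr l) ∈ F := by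
    have hc := quadWalk_isCycle (i := 1) (k := 2) hj hl (by decide) hjl
    have hodd := (hA _ _ hc rfl (by simp [support_quadWalk])
      (by simp [support_quadWalk, hj.symm, hl.symm])).not.mpr (by simp [edges_quadWalk])
    refine mem_or_mem_of_two_le_card (k := 2) hF hj hl (not_le.mp fun hle => hodd ?_)
    exact (hB _ _ hc rfl (by simp [support_quadWalk])
      (by simp [support_quadWalk, hj.symm, hl.symm])).mpr hle
  have unique {j l : Fin 4} (hjl : j ≠ l) (h₁ : s(Sum.inl 1, Sum.inr j) ∈ F)
      (h₂ : s(Sum.inl 1, Sum.inr l) ∈ F) : False :=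
    hF _ h₁ _ h₂ (by simpa using hjl) (Sum.inl 1) (by simp)
  have h₁₂ := key (j := 1) (l := 2) (by decide) (by decide) (by decide)
  have h₁₃ := key (j := 1) (l := 3) (by decide) (by decide) (by decide)
  have h₂₃ := key (j := 2) (l := 3) (by decide) (by decide) (by decide)
  have u₁₂ := unique (j := 1) (l := 2) (by decide)
  have u₁₃ := unique (j := 1) (l := 3) (by decide)
  have u₂₃ := unique (j := 2) (l := 3) (by decide)
  tauto
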